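/- arXiv:1709.06403 — 2 statements merged into one kernel-verified Lean document; each statement's English description precedes it below -/
import Mathlib

section
/- Let S be a continuous basic cover and let ε_L : L(S) → S be the perfect basic cover map defined by 𝔄 ε_L a iff 𝔄 ◁_{L(S)} {r(a)}. For any compact regular formal topology S′ and any perfect basic cover map r : S′ → S, there exists a unique formal topology map r̃ : S′ → L(S) such that ε_L ∘ r̃ = r. Consequently, the forgetful functor from the category of compact regular formal topologies to the category of continuous basic covers and perfect maps has a right adjoint, given by the Lawson topology construction. -/
noncomputable section
open Classical

universe u v

namespace FTP

/-! ### Basic covers -/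

/-- `U ◁ V` : every element of `U` is covered by `V`. -/
def covS {S : Type*} (cov : S → Set S → Prop) (U V : Set S) : Prop :=
  ∀ a ∈ U, cov a V

/-- A basic cover: reflexivity and transitivity. -/
def IsBasicCover {S : Type*} (cov : S → Set S → Prop) : Prop :=
  (∀ (a : S) (U : Set S), a ∈ U → cov a U) ∧
  (∀ (a : S) (U V : Set S), cov a U → covS cov U V → cov a V)

/-- the way-below relation `a ≪ b`. -/
def wb {S : Type*} (cov : S → Set S → Prop) (a b : S) : Prop :=
  ∀ U : Set S, cov b U → ∃ U₀ : Finset S, ↑U₀ ⊆ U ∧ cov a ↑U₀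

/-- the way-below relation between subsets `U ≪ V`. -/
def wbS {S : Type*} (cov : S → Set S → Prop) (U V : Set S) : Prop :=
  ∀ W : Set S, covS cov V W → ∃ W₀ : Finset S, ↑W₀ ⊆ W ∧ covS cov U ↑W₀

/-- A continuous basic cover, with the witnessing function `w`. -/
def IsContinuous {S : Type*} (cov : S → Set S → Prop) (w : S → Set S) : Prop :=
  (∀ a : S, ∀ b ∈ w a, wb cov b a) ∧ (∀ a : S, cov a (w a))

/-- splitting subsets. -/
def Splitting {S : Type*} (cov : S → Set S → Prop) (V : Set S) : Prop :=
  ∀ (a : S) (U : Set S), a ∈ V → cov a U → (V ∩ U).Nonempty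

/-- located subsets. -/
def Located {S : Type*} (cov : S → Set S → Prop) (V : Set S) : Prop :=
  Splitting cov V ∧ ∀ a b : S, wb cov a b → a ∉ V ∨ b ∈ V

/-- inverse image of a relation. -/
def rinv {α β : Type*} (r : α → β → Prop) (U : Set β) : Set α :=
  {x | ∃ a ∈ U, r x a}

/-- basic cover maps. -/
def IsBCM {α β : Type*} (cov : α → Set α → Prop) (cov' : β → Set β → Prop)
    (r : α → β → Prop) : Prop :=
  ∀ (a : β) (U : Set β), cov' a U → covS cov (rinv r {a}) (rinv r U)

/-- perfect maps. -/
def IsPerfect {α β : Type*} (cov : α → Set α → Prop) (cov' : β → Set β → Prop)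
    (r : α → β → Prop) : Prop :=
  ∀ a b : β, wb cov' a b → wbS cov (rinv r {a}) (rinv r {b})

/-- the terminal basic cover `1 = ({∗}, ∈)`. -/
def unitCov : Unit → Set Unit → Prop := fun x U => x ∈ U

/-! ### Formal topologies -/

/-- `U ↓ V` with respect to a preorder `le`. -/
def down {S : Type*} (le : S → S → Prop) (U V : Set S) : Set S :=
  {c | ∃ a ∈ U, ∃ b ∈ V, le c a ∧ le c b}

/-- A formal topology: a basic cover together with a compatible preorder. -/
def IsFormalTopology {S : Type*} (cov : S → Set S → Prop) (le : S → S → Prop) : Prop :=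
  IsBasicCover cov ∧ Reflexive le ∧ Transitive le ∧
  (∀ a b : S, le a b → cov a {b}) ∧
  (∀ (a : S) (U V : Set S), cov a U → cov a V → cov a (down le U V))

/-- formal topology maps. -/
def IsFTM {α β : Type*} (cov : α → Set α → Prop) (le : α → α → Prop)
    (cov' : β → Set β → Prop) (le' : β → β → Prop) (r : α → β → Prop) : Prop :=
  IsBCM cov cov' r ∧
  covS cov Set.univ (rinv r Set.univ) ∧
  ∀ a b : β, covS cov (down le (rinv r {a}) (rinv r {b})) (rinv r (down le' {a} {b}))

/-- the order on maps. -/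
def MapLE {α β : Type*} (cov : α → Set α → Prop) (r s : α → β → Prop) : Prop :=
  ∀ a : β, covS cov (rinv r {a}) (rinv s {a})

/-- equality of maps. -/
def MapEq {α β : Type*} (cov : α → Set α → Prop) (r s : α → β → Prop) : Prop :=
  MapLE cov r s ∧ MapLE cov s r

/-- composition of relational maps (`comp s r = s ∘ r`). -/
def comp {α β γ : Type*} (s : β → γ → Prop) (r : α → β → Prop) : α → γ → Prop :=
  fun x c => ∃ b, r x b ∧ s b c

/-- `b* = {c | c ↓ b ◁ ∅}`. -/
def star {S : Type*} (cov : S → Set S → Prop) (le : S → S → Prop) (b : S) : Set S :=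
  {c | covS cov (down le {c} {b}) ∅}

/-- `b ⋘ a` iff `S ◁ b* ∪ {a}`. -/
def wc {S : Type*} (cov : S → Set S → Prop) (le : S → S → Prop) (b a : S) : Prop :=
  covS cov Set.univ (star cov le b ∪ {a})

/-- regular formal topologies. -/
def Regular {S : Type*} (cov : S → Set S → Prop) (le : S → S → Prop) : Prop :=
  ∀ a : S, cov a {b | wc cov le b a}

/-- compactness: `S ≪ S`. -/
def Compact {S : Type*} (cov : S → Set S → Prop) : Prop :=
  wbS cov Set.univ Set.univ

/-- stability: `a ≪ a'` and `b ≪ b'` imply `a↓b ≪ a'↓b'`. -/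
def Stable {S : Type*} (cov : S → Set S → Prop) (le : S → S → Prop) : Prop :=
  ∀ a a' b b' : S, wb cov a a' → wb cov b b' →
    wbS cov (down le {a} {b}) (down le {a'} {b'})

/-- isomorphism of formal topologies. -/
def IsIso {α β : Type*} (cov : α → Set α → Prop) (le : α → α → Prop)
    (cov' : β → Set β → Prop) (le' : β → β → Prop) : Prop :=
  ∃ (r : α → β → Prop) (s : β → α → Prop),
    IsFTM cov le cov' le' r ∧ IsFTM cov' le' cov le s ∧
    MapEq cov (comp s r) (fun a b => a = b) ∧
    MapEq cov' (comp r s) (fun a b => a = b)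

/-! ### Geometric theories and the covers they present -/

/-- the preorder `A ≤ B ↔ B ⊆ A` on finite sets of generators. -/
def supord {P : Type*} : Finset P → Finset P → Prop := fun A B => B ⊆ A

/-- The cover on `Finset P` inductively generated by a geometric theory `T`
(an axiom `T A 𝒞` means `⋀A ⊢ ⋁_{B ∈ 𝒞} ⋀B`). -/
inductive GCov {P : Type*} (T : Finset P → Set (Finset P) → Prop) :
    Finset P → Set (Finset P) → Prop where
  | refl {A : Finset P} {𝒰 : Set (Finset P)} : A ∈ 𝒰 → GCov T A 𝒰
  | le {A B : Finset P} {𝒰 : Set (Finset P)} : B ⊆ A → GCov T B 𝒰 → GCov T A 𝒰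
  | ax {A : Finset P} {𝒞 𝒰 : Set (Finset P)} (C : Finset P) :
      T A 𝒞 → (∀ B ∈ 𝒞, GCov T (C ∪ B) 𝒰) → GCov T (C ∪ A) 𝒰

theorem GCov_trans {P : Type*} {T : Finset P → Set (Finset P) → Prop}
    {A : Finset P} {𝒰 𝒱 : Set (Finset P)}
    (h : GCov T A 𝒰) (h' : ∀ B ∈ 𝒰, GCov T B 𝒱) : GCov T A 𝒱 := by
  induction h with
  | refl hA => exact h' _ hA
  | le hBA _ ih => exact GCov.le hBA (ih h')
  | ax C hT _ ih => exact GCov.ax C hT (fun B hB => ih B hB h')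

theorem GCov_isBasicCover {P : Type*} (T : Finset P → Set (Finset P) → Prop) :
    IsBasicCover (GCov T) :=
  ⟨fun _ _ h => GCov.refl h, fun _ _ _ h h' => GCov_trans h h'⟩

/-! ### The patch, Lawson and lower powerlocale theories -/

/-- generators of the patch/Lawson theories : `r a` and `l A`. -/
inductive PatchGen (S : Type u) : Type u where
  | r : S → PatchGen S
  | l : Finset S → PatchGen S

/-- The geometric theory `T_P` presenting the patch of a stably locally compact
formal topology. -/
inductive PatchThy {S : Type*} (cov : S → Set S → Prop) (le : S → S → Prop) :
    Finset (PatchGen S) → Set (Finset (PatchGen S)) → Prop where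
  | R1 : PatchThy cov le ∅ {B | ∃ a : S, B = {PatchGen.r a}}
  | R2 (a b : S) :
      PatchThy cov le {PatchGen.r a, PatchGen.r b}
        {B | ∃ c ∈ down le {a} {b}, B = {PatchGen.r c}}
  | R3 (a : S) (A : Finset S) :
      cov a ↑A → PatchThy cov le {PatchGen.r a} {B | ∃ b ∈ A, B = {PatchGen.r b}}
  | R4 (a : S) :
      PatchThy cov le {PatchGen.r a} {B | ∃ b : S, wb cov b a ∧ B = {PatchGen.r b}}
  | L1 : PatchThy cov le ∅ {({PatchGen.l ∅} : Finset (PatchGen S))}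
  | L2 (A B : Finset S) :
      covS cov ↑A ↑B →
      PatchThy cov le {PatchGen.l B} {({PatchGen.l A} : Finset (PatchGen S))}
  | L3 (A B : Finset S) :
      PatchThy cov le {PatchGen.l A, PatchGen.l B}
        {D | ∃ C : Finset S, wbS cov ↑A ↑C ∧ wbS cov ↑B ↑C ∧ D = {PatchGen.l C}}
  | Loc (a b : S) :
      wb cov a b →
      PatchThy cov le ∅
        {({PatchGen.l {a}} : Finset (PatchGen S)), ({PatchGen.r b} : Finset (PatchGen S))}
  | D (a : S) :
      PatchThy cov le {PatchGen.l {a}, PatchGen.r a} (∅ : Set (Finset (PatchGen S)))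

/-- the cover of `Patch(S)`. -/
def patchCov {S : Type*} (cov : S → Set S → Prop) (le : S → S → Prop) :
    Finset (PatchGen S) → Set (Finset (PatchGen S)) → Prop :=
  GCov (PatchThy cov le)

/-- the counit `ε_P : Patch(S) → S`. -/
def epsP {S : Type*} (cov : S → Set S → Prop) (le : S → S → Prop) :
    Finset (PatchGen S) → S → Prop :=
  fun 𝔄 a => patchCov cov le 𝔄 {({PatchGen.r a} : Finset (PatchGen S))}

/-- The geometric theory `T_L` presenting the Lawson topology of a continuous
basic cover (the axioms of `T_P` without (R1), (R2)). -/
inductive LawsonThy {S : Type*} (cov : S → Set S → Prop) :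
    Finset (PatchGen S) → Set (Finset (PatchGen S)) → Prop where
  | R3 (a : S) (A : Finset S) :
      cov a ↑A → LawsonThy cov {PatchGen.r a} {B | ∃ b ∈ A, B = {PatchGen.r b}}
  | R4 (a : S) :
      LawsonThy cov {PatchGen.r a} {B | ∃ b : S, wb cov b a ∧ B = {PatchGen.r b}}
  | L1 : LawsonThy cov ∅ {({PatchGen.l ∅} : Finset (PatchGen S))}
  | L2 (A B : Finset S) :
      covS cov ↑A ↑B →
      LawsonThy cov {PatchGen.l B} {({PatchGen.l A} : Finset (PatchGen S))}
  | L3 (A B : Finset S) :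
      LawsonThy cov {PatchGen.l A, PatchGen.l B}
        {D | ∃ C : Finset S, wbS cov ↑A ↑C ∧ wbS cov ↑B ↑C ∧ D = {PatchGen.l C}}
  | Loc (a b : S) :
      wb cov a b →
      LawsonThy cov ∅
        {({PatchGen.l {a}} : Finset (PatchGen S)), ({PatchGen.r b} : Finset (PatchGen S))}
  | D (a : S) :
      LawsonThy cov {PatchGen.l {a}, PatchGen.r a} (∅ : Set (Finset (PatchGen S)))

/-- the cover of the Lawson topology `L(S)`. -/
def lawsonCov {S : Type*} (cov : S → Set S → Prop) :
    Finset (PatchGen S) → Set (Finset (PatchGen S)) → Prop :=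
  GCov (LawsonThy cov)

/-- the counit `ε_L : L(S) → S`. -/
def epsL {S : Type*} (cov : S → Set S → Prop) : Finset (PatchGen S) → S → Prop :=
  fun 𝔄 a => lawsonCov cov 𝔄 {({PatchGen.r a} : Finset (PatchGen S))}

/-- The theory presenting the lower powerlocale of a continuous basic cover:
generators `a ∈ S`, axioms (R3) and (R4). -/
inductive LowerThy {S : Type*} (cov : S → Set S → Prop) :
    Finset S → Set (Finset S) → Prop where
  | R3 (a : S) (A : Finset S) :
      cov a ↑A → LowerThy cov {a} {B | ∃ b ∈ A, B = ({b} : Finset S)}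
  | R4 (a : S) :
      LowerThy cov {a} {B | ∃ b : S, wb cov b a ∧ B = ({b} : Finset S)}

/-- the cover of the lower powerlocale `Lower(S)`. -/
def lowerCov {S : Type*} (cov : S → Set S → Prop) :
    Finset S → Set (Finset S) → Prop :=
  GCov (LowerThy cov)

/-- the counit `σ_L : Lower(S) → S`. -/
def sigmaL {S : Type*} (cov : S → Set S → Prop) : Finset S → S → Prop :=
  fun A a => lowerCov cov A ({({a} : Finset S)} : Set (Finset S))

/-! ### de Groot duals -/

/-- `↟A = {B ∈ Fin S | A ≪ B}`. -/
def upF {S : Type*} (cov : S → Set S → Prop) (A : Finset S) : Set (Finset S) :=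
  {B | wbS cov ↑A ↑B}

/-- the finite join `⋁^F {↟A | A ∈ 𝒜}` of Scott open filters. -/
def finJoin {S : Type*} (cov : S → Set S → Prop) (le : S → S → Prop)
    (𝒜 : Finset (Finset S)) : Set (Finset S) :=
  if 𝒜 = ∅ then {B | covS cov Set.univ ↑B}
  else {B | ∃ g : Finset S → Finset S,
    (∀ A ∈ 𝒜, wbS cov ↑A ↑(g A)) ∧
    wbS cov {c | ∀ A ∈ 𝒜, ∃ b ∈ g A, le c b} ↑B}

/-- The cover `◁^D` of the de Groot dual `S^D`, inductively generated on
`(Fin S, ⊇)` by the axioms (D3) `A ◁ ↟A` and (D4). -/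
inductive DCov {S : Type*} (cov : S → Set S → Prop) (le : S → S → Prop) :
    Finset S → Set (Finset S) → Prop where
  | refl {A : Finset S} {𝒰 : Set (Finset S)} : A ∈ 𝒰 → DCov cov le A 𝒰
  | le {A B : Finset S} {𝒰 : Set (Finset S)} :
      B ⊆ A → DCov cov le B 𝒰 → DCov cov le A 𝒰
  | d3 {A A' : Finset S} {𝒰 : Set (Finset S)} :
      A ⊆ A' →
      (∀ C : Finset S, A' ⊆ C → (∃ B : Finset S, wbS cov ↑A ↑B ∧ B ⊆ C) →
        DCov cov le C 𝒰) →
      DCov cov le A' 𝒰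
  | d4 {A A' : Finset S} {𝒜 : Finset (Finset S)} {𝒰 : Set (Finset S)} :
      A ⊆ A' → upF cov A ⊆ finJoin cov le 𝒜 →
      (∀ C : Finset S, A' ⊆ C → (∃ B ∈ 𝒜, B ⊆ C) → DCov cov le C 𝒰) →
      DCov cov le A' 𝒰

/-- the cover of the Scott topology `Σ(S)` on `(Fin S, ⊇)`. -/
def scottCov {S : Type*} (cov : S → Set S → Prop) :
    Finset S → Set (Finset S) → Prop :=
  fun A 𝒰 => upF cov A ⊆ ⋃ B ∈ 𝒰, upF cov B

/-- a filter (with respect to `◁`) of basic opens, given by a set of finite subsets. -/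
def IsCovFilter {S : Type*} (cov : S → Set S → Prop) (le : S → S → Prop)
    (𝒱 : Set (Finset S)) : Prop :=
  𝒱.Nonempty ∧
  (∀ A ∈ 𝒱, ∀ B : Finset S, covS cov ↑A ↑B → B ∈ 𝒱) ∧
  (∀ A ∈ 𝒱, ∀ B ∈ 𝒱, ∃ C ∈ 𝒱, covS cov ↑C (down le ↑A ↑B))

/-- The geometric theory `T^d` presenting the de Groot dual `S^d`:
generators `l A` (identified with `A : Finset S`), axioms (L1)–(L3) and (D4). -/
inductive DGThy {S : Type*} (cov : S → Set S → Prop) (le : S → S → Prop) :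
    Finset (Finset S) → Set (Finset (Finset S)) → Prop where
  | L1 : DGThy cov le ∅ {({(∅ : Finset S)} : Finset (Finset S))}
  | L2 (A B : Finset S) :
      covS cov ↑A ↑B → DGThy cov le {B} {({A} : Finset (Finset S))}
  | L3 (A B : Finset S) :
      DGThy cov le {A, B}
        {D | ∃ C : Finset S, wbS cov ↑A ↑C ∧ wbS cov ↑B ↑C ∧ D = ({C} : Finset (Finset S))}
  | D4 (A : Finset S) (𝒜 : Finset (Finset S)) :
      upF cov A ⊆ finJoin cov le 𝒜 →
      DGThy cov le {A} {D | ∃ B ∈ 𝒜, D = ({B} : Finset (Finset S))}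

/-! ### Spectral formal topologies -/

/-- spectral formal topologies: a compatible meet-semilattice structure on the
base, with every basic element way-below itself. -/
def IsSpectral {S : Type*} (cov : S → Set S → Prop) (le : S → S → Prop)
    (one : S) (meet : S → S → S) : Prop :=
  (∀ a : S, cov a {one}) ∧
  (∀ a b : S, cov (meet a b) (down le {a} {b})) ∧
  (∀ a b : S, ∀ c ∈ down le {a} {b}, cov c {meet a b}) ∧
  (∀ a : S, wb cov a a)

/-! ### Subtopologies -/

/-- the property of being a formal-topology cover compatible with `le`. -/
def IsFTCover {S : Type*} (cov : S → Set S → Prop) (le : S → S → Prop) : Prop :=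
  IsBasicCover cov ∧ (∀ a b : S, le a b → cov a {b}) ∧
  (∀ (a : S) (U V : Set S), cov a U → cov a V → cov a (down le U V))

/-- The meet (in `SubTop(S)`) of a family of subtopology covers: the least
formal-topology cover containing all of them. -/
def covMeet {S : Type*} {ι : Sort*} (le : S → S → Prop)
    (F : ι → (S → Set S → Prop)) : S → Set S → Prop :=
  fun a U => ∀ c : S → Set S → Prop,
    IsFTCover c le → (∀ i : ι, ∀ (a' : S) (U' : Set S), F i a' U' → c a' U') → c a U

/-- the closed subtopology `C_a` determined by `{a}`. -/
def closedCov {S : Type*} (cov : S → Set S → Prop) (a : S) : S → Set S → Prop :=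
  fun c V => cov c ({a} ∪ V)

/-- the open subtopology `S_B` determined by a finite `B`. -/
def openCov {S : Type*} (cov : S → Set S → Prop) (le : S → S → Prop)
    (B : Finset S) : S → Set S → Prop :=
  fun c V => covS cov (down le {c} ↑B) V

/-- `K_A = ⋀_{A ≪ B} S_B`. -/
def KCov {S : Type*} (cov : S → Set S → Prop) (le : S → S → Prop) (A : Finset S) :
    S → Set S → Prop :=
  covMeet le (fun B : {B : Finset S // wbS cov ↑A ↑B} => openCov cov le B.1)

/-- `C_a ∨ K_A` (the join of subtopologies is the intersection of covers). -/
def CKCov {S : Type*} (cov : S → Set S → Prop) (le : S → S → Prop)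
    (a : S) (A : Finset S) : S → Set S → Prop :=
  fun c V => closedCov cov a c V ∧ KCov cov le A c V

/-- perfect subtopologies. -/
def IsPerfectSub {S : Type*} (cov : S → Set S → Prop) (le : S → S → Prop)
    (cov' : S → Set S → Prop) : Prop :=
  IsFTCover cov' le ∧ (∀ (a : S) (U : Set S), cov a U → cov' a U) ∧
  (∀ a b : S, wb cov a b → wb cov' a b)

/-- the order of `PSub(S)`: `(a,A) ≤ (b,B)` iff `C_b ∨ K_B ⊑ C_a ∨ K_A`. -/
def PSubLe {S : Type*} (cov : S → Set S → Prop) (le : S → S → Prop) :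
    S × Finset S → S × Finset S → Prop :=
  fun p q => ∀ (c : S) (V : Set S), CKCov cov le p.1 p.2 c V → CKCov cov le q.1 q.2 c V

/-- the cover of `PSub(S)`: `(a,A) ◁ U` iff `⋀{C_b ∨ K_B | (b,B) ∈ U} ⊑ C_a ∨ K_A`. -/
def covPSub {S : Type*} (cov : S → Set S → Prop) (le : S → S → Prop) :
    S × Finset S → Set (S × Finset S) → Prop :=
  fun p U => ∀ (c : S) (V : Set S), CKCov cov le p.1 p.2 c V →
    covMeet le (fun q : U => CKCov cov le q.1.1 q.1.2) c V

/-- the map `r : PSub(S) → Patch(S)` on generators. -/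
def rGenPS {S : Type*} (cov : S → Set S → Prop) (le : S → S → Prop)
    (p : S × Finset S) : PatchGen S → Prop
  | PatchGen.r b => covPSub cov le p {((b, (∅ : Finset S)) : S × Finset S)}
  | PatchGen.l B => covPSub cov le p {q : S × Finset S | q.2 = B}

/-- the map `r : PSub(S) → Patch(S)`, extended along the presentation. -/
def rPS {S : Type*} (cov : S → Set S → Prop) (le : S → S → Prop) :
    S × Finset S → Finset (PatchGen S) → Prop :=
  fun p 𝔅 => ∀ g ∈ 𝔅, covPSub cov le p (rinv (fun q g' => rGenPS cov le q g') {g})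

/-- the map `s : Patch(S) → PSub(S)`. -/
def sPS {S : Type*} (cov : S → Set S → Prop) (le : S → S → Prop) :
    Finset (PatchGen S) → (S × Finset S) → Prop :=
  fun 𝔄 p => patchCov cov le 𝔄
    ({({PatchGen.r p.1, PatchGen.l p.2} : Finset (PatchGen S))} : Set (Finset (PatchGen S)))

/-! ### Saturated subsets, dcpos and preframes -/

/-- the saturated subsets of a basic cover. -/
abbrev SatSet {α : Type*} (cov : α → Set α → Prop) : Type _ :=
  {U : Set α // ∀ a, cov a U → a ∈ U}

/-- the join of a family of saturated subsets. -/
def satSup {α : Type*} {cov : α → Set α → Prop} (hbc : IsBasicCover cov)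
    (D : Set (SatSet cov)) : SatSet cov :=
  ⟨{a | cov a (⋃ U ∈ D, (U : Set α))}, fun a h => hbc.2 a _ _ h (fun _ hb => hb)⟩

/-- inductively generated basic covers: `BGen Ax` is the cover generated by the
axiom-set with axioms `a ◁ C` for `C ∈ Ax a`. -/
inductive BGen {S : Type*} (Ax : S → Set (Set S)) : S → Set S → Prop where
  | refl {a : S} {U : Set S} : a ∈ U → BGen Ax a U
  | infty {a : S} {U : Set S} (C : Set S) :
      C ∈ Ax a → (∀ b ∈ C, BGen Ax b U) → BGen Ax a U

theorem BGen_trans {S : Type*} {Ax : S → Set (Set S)} {a : S} {U V : Set S}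
    (h : BGen Ax a U) (h' : ∀ b ∈ U, BGen Ax b V) : BGen Ax a V := by
  induction h with
  | refl ha => exact h' _ ha
  | infty C hC _ ih => exact BGen.infty C hC (fun b hb => ih b hb h')

theorem BGen_isBasicCover {S : Type*} (Ax : S → Set (Set S)) :
    IsBasicCover (BGen Ax) :=
  ⟨fun _ _ h => BGen.refl h, fun _ _ _ h h' => BGen_trans h h'⟩

/-- the lower powerlocale theory of an inductively generated basic cover. -/
inductive LowerThyAx {S : Type*} (Ax : S → Set (Set S)) :
    Finset S → Set (Finset S) → Prop where
  | mk (a : S) (C : Set S) :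
      C ∈ Ax a → LowerThyAx Ax {a} {B | ∃ b ∈ C, B = ({b} : Finset S)}

/-- the counit `σ_L : Lower(S) → S` for an inductively generated basic cover. -/
def sigmaLAx {S : Type*} (Ax : S → Set (Set S)) : Finset S → S → Prop :=
  fun A a => GCov (LowerThyAx Ax) A ({({a} : Finset S)} : Set (Finset S))

/-- the top saturated subset of a presented topology. -/
def satTop {P : Type*} (T : Finset P → Set (Finset P) → Prop) : SatSet (GCov T) :=
  ⟨Set.univ, fun _ _ => Set.mem_univ _⟩

/-- binary meets of saturated subsets of a presented topology. -/
def satInfL {P : Type*} (T : Finset P → Set (Finset P) → Prop)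
    (U V : SatSet (GCov T)) : SatSet (GCov T) :=
  ⟨{A | GCov T A (down supord (U : Set (Finset P)) (V : Set (Finset P)))},
   fun _ h => GCov_trans h (fun _ hB => hB)⟩

/-- the suplattice homomorphism `σ_L* : Sat(S) → Sat(Lower(S))`. -/
def sigmaStar {S : Type*} (Ax : S → Set (Set S)) (U : SatSet (BGen Ax)) :
    SatSet (GCov (LowerThyAx Ax)) :=
  ⟨{A : Finset S | GCov (LowerThyAx Ax) A (rinv (sigmaLAx Ax) (U : Set S))},
   fun _ h => GCov_trans h (fun _ hB => hB)⟩

/-- a preframe structure on a partial order: finite meets and directed joins,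
with finite meets distributing over directed joins. -/
structure PreframeStr (X : Type*) [PartialOrder X] where
  top : X
  inf : X → X → X
  dSup : Set X → X
  le_top : ∀ x, x ≤ top
  inf_le_left : ∀ x y, inf x y ≤ x
  inf_le_right : ∀ x y, inf x y ≤ y
  le_inf : ∀ x y z, x ≤ y → x ≤ z → x ≤ inf y z
  le_dSup : ∀ d : Set X, d.Nonempty → DirectedOn (· ≤ ·) d → ∀ x ∈ d, x ≤ dSup d
  dSup_le : ∀ d : Set X, d.Nonempty → DirectedOn (· ≤ ·) d →
    ∀ z, (∀ x ∈ d, x ≤ z) → dSup d ≤ z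
  distrib : ∀ (x : X) (d : Set X), d.Nonempty → DirectedOn (· ≤ ·) d →
    inf x (dSup d) = dSup ((fun y => inf x y) '' d)

/-- dcpo homomorphisms out of `Sat(S)`. -/
def IsDcpoHom {α : Type*} {cov : α → Set α → Prop} (hbc : IsBasicCover cov)
    {X : Type*} [PartialOrder X] (PF : PreframeStr X) (f : SatSet cov → X) : Prop :=
  Monotone f ∧
  ∀ D : Set (SatSet cov), D.Nonempty → DirectedOn (· ≤ ·) D →
    f (satSup hbc D) = PF.dSup (f '' D)

/-- preframe homomorphisms out of the frame of a presented topology. -/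
def IsPreframeHomL {P : Type*} (T : Finset P → Set (Finset P) → Prop)
    {X : Type*} [PartialOrder X] (PF : PreframeStr X)
    (F : SatSet (GCov T) → X) : Prop :=
  Monotone F ∧ F (satTop T) = PF.top ∧
  (∀ U V, F (satInfL T U V) = PF.inf (F U) (F V)) ∧
  ∀ D : Set (SatSet (GCov T)), D.Nonempty → DirectedOn (· ≤ ·) D →
    F (satSup (GCov_isBasicCover T) D) = PF.dSup (F '' D)

/-! ### Located subsets: auxiliary notions -/

/-- the lower part `L_V` associated to a located subset `V`. -/
def LV {S : Type*} (cov : S → Set S → Prop) (V : Set S) : Set S :=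
  {a | ∃ A : Finset S, wbS cov {a} ↑A ∧ (↑A ∩ V : Set S) = ∅}

/-- cuts of a continuous basic cover. -/
def IsCut {S : Type*} (cov : S → Set S → Prop) (L U : Set S) : Prop :=
  (∀ (a : S) (A : Finset S), cov a ↑A → a ∈ U → ((↑A : Set S) ∩ U).Nonempty) ∧
  (∀ a ∈ U, ∃ b : S, wb cov b a ∧ b ∈ U) ∧
  (∀ (a : S) (A : Finset S), cov a ↑A → (↑A : Set S) ⊆ L → a ∈ L) ∧
  (∀ a ∈ L, ∃ A : Finset S, wbS cov {a} ↑A ∧ (↑A : Set S) ⊆ L) ∧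
  (∀ a b : S, wb cov a b → a ∈ L ∨ b ∈ U) ∧
  L ∩ U = ∅

end FTP

namespace FTP

/-! ### Finite choice -/

theorem exists_finset_choice {α β : Type*} {P : α → β → Prop} (F : Finset α)
    (h : ∀ f ∈ F, ∃ y, P f y) :
    ∃ C : Finset β, (∀ f ∈ F, ∃ y ∈ C, P f y) ∧ ∀ y ∈ C, ∃ f ∈ F, P f y := by
  choose g hg using fun f : F => h f.1 f.2
  refine ⟨Finset.univ.image g, fun f hf => ?_, fun y hy => ?_⟩
  · exact ⟨g ⟨f, hf⟩, Finset.mem_image_of_mem _ (Finset.mem_univ _), hg ⟨f, hf⟩⟩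
  · obtain ⟨f, -, rfl⟩ := Finset.mem_image.1 hy
    exact ⟨f.1, f.2, hg f⟩

theorem exists_finset_subset_forall {α β : Type*} {P : α → Set β → Prop} {U : Set β}
    (hP : ∀ a V W, V ⊆ W → P a V → P a W) (F : Finset α)
    (h : ∀ f ∈ F, ∃ V : Finset β, ↑V ⊆ U ∧ P f ↑V) :
    ∃ V : Finset β, ↑V ⊆ U ∧ ∀ f ∈ F, P f ↑V := by
  obtain ⟨C, hC, hC'⟩ := exists_finset_choice F h
  refine ⟨C.biUnion id, fun x hx => ?_, fun f hf => ?_⟩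
  · obtain ⟨V, hV, hx⟩ := Finset.mem_biUnion.1 (Finset.mem_coe.1 hx)
    obtain ⟨f, -, hVU, -⟩ := hC' V hV
    exact hVU hx
  · obtain ⟨V, hV, -, hfV⟩ := hC f hf
    exact hP f _ _ (Finset.coe_subset.2 (Finset.subset_biUnion_of_mem id hV)) hfV

/-! ### Basic covers -/

section BasicCover

variable {S : Type*} {cov : S → Set S → Prop}

theorem IsBasicCover.mono (h : IsBasicCover cov) {a : S} {U V : Set S} (hUV : U ⊆ V)
    (ha : cov a U) : cov a V :=
  h.2 a U V ha fun b hb => h.1 b V (hUV hb)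

theorem IsBasicCover.covS_of_subset (h : IsBasicCover cov) {U V : Set S} (hUV : U ⊆ V) :
    covS cov U V :=
  fun b hb => h.1 b V (hUV hb)

theorem IsBasicCover.covS_trans (h : IsBasicCover cov) {U V W : Set S}
    (h₁ : covS cov U V) (h₂ : covS cov V W) : covS cov U W :=
  fun b hb => h.2 b V W (h₁ b hb) h₂

theorem wbS_of_forall_wb (h : IsBasicCover cov) {U V : Set S} (F : Finset S)
    (hU : covS cov U ↑F) (hF : ∀ f ∈ F, ∃ v ∈ V, wb cov f v) : wbS cov U V := by
  intro W hW
  obtain ⟨W₀, hW₀, hc⟩ := exists_finset_subset_forall (P := cov)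
    (fun _ _ _ hVW ha => h.mono hVW ha) F
    (fun f hf => by
      obtain ⟨v, hv, hfv⟩ := hF f hf
      exact hfv W (hW v hv))
  exact ⟨W₀, hW₀, fun a ha => h.2 a _ _ (hU a ha) hc⟩

theorem wbS_singleton_of_wb (h : IsBasicCover cov) {a b : S} (hab : wb cov a b) :
    wbS cov {a} {b} :=
  wbS_of_forall_wb h {a} (h.covS_of_subset (by simp)) (by simpa using hab)

theorem covS_of_wbS (h : IsBasicCover cov) {U V : Set S} (hUV : wbS cov U V) :
    covS cov U V := by
  obtain ⟨W, hW, hU⟩ := hUV V (h.covS_of_subset subset_rfl)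
  exact fun a ha => h.mono hW (hU a ha)

theorem wbS_of_covS_left (h : IsBasicCover cov) {U V W : Set S} (hUV : covS cov U V)
    (hVW : wbS cov V W) : wbS cov U W := by
  intro X hX
  obtain ⟨Y, hY, hVY⟩ := hVW X hX
  exact ⟨Y, hY, h.covS_trans hUV hVY⟩

theorem wbS_empty (V : Set S) : wbS cov ∅ V :=
  fun _ _ => ⟨∅, by simp, fun _ ha => ha.elim⟩

theorem wbS_union (h : IsBasicCover cov) {U V U' V' : Set S} (hU : wbS cov U U')
    (hV : wbS cov V V') : wbS cov (U ∪ V) (U' ∪ V') := by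
  intro W hW
  obtain ⟨X, hX, hUX⟩ := hU W fun a ha => hW a (Or.inl ha)
  obtain ⟨Y, hY, hVY⟩ := hV W fun a ha => hW a (Or.inr ha)
  refine ⟨X ∪ Y, by simp [hX, hY], ?_⟩
  rintro a (ha | ha)
  · exact h.mono (by simp) (hUX a ha)
  · exact h.mono (by simp) (hVY a ha)

variable {w : S → Set S}

theorem IsContinuous.cov_wb (h : IsBasicCover cov) (hw : IsContinuous cov w) (a : S) :
    cov a {b | wb cov b a} :=
  h.mono (hw.1 a) (hw.2 a)

theorem IsContinuous.exists_finset_wb (h : IsBasicCover cov) (hw : IsContinuous cov w)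
    {U V : Set S} (hUV : wbS cov U V) :
    ∃ F : Finset S, covS cov U ↑F ∧ ∀ f ∈ F, ∃ v ∈ V, wb cov f v := by
  obtain ⟨F, hF, hU⟩ := hUV {f | ∃ v ∈ V, wb cov f v} fun v hv =>
    h.mono (fun _ hf => ⟨v, hv, hf⟩) (hw.cov_wb h v)
  exact ⟨F, hU, fun f hf => hF hf⟩

theorem IsContinuous.exists_between (h : IsBasicCover cov) (hw : IsContinuous cov w)
    {U V : Set S} (hUV : wbS cov U V) :
    ∃ C : Finset S, wbS cov U ↑C ∧ ∀ c ∈ C, ∃ v ∈ V, wb cov c v := by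
  obtain ⟨F, hF, hU⟩ := hUV {f | ∃ y, wb cov f y ∧ ∃ v ∈ V, wb cov y v} fun v hv =>
    h.2 _ _ _ (hw.cov_wb h v) fun y hy =>
      h.mono (fun _ hf => ⟨y, hf, v, hv, hy⟩) (hw.cov_wb h y)
  obtain ⟨C, hC, hC'⟩ := exists_finset_choice F fun f hf => hF hf
  refine ⟨C, wbS_of_forall_wb h F hU fun f hf => ?_, fun c hc => ?_⟩
  · obtain ⟨y, hy, hfy, -⟩ := hC f hf
    exact ⟨y, hy, hfy⟩
  · obtain ⟨f, -, -, hv⟩ := hC' c hc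
    exact hv

theorem IsContinuous.interpolate (h : IsBasicCover cov) (hw : IsContinuous cov w)
    {U V : Set S} (hUV : wbS cov U V) :
    ∃ C : Finset S, wbS cov U ↑C ∧ wbS cov ↑C V := by
  obtain ⟨C, hC, hC'⟩ := hw.exists_between h hUV
  exact ⟨C, hC, wbS_of_forall_wb h C (h.covS_of_subset subset_rfl) hC'⟩

end BasicCover

/-! ### Presented covers -/

section GCov

variable {P : Type*} {T : Finset P → Set (Finset P) → Prop}

theorem GCov.mono {A : Finset P} {U V : Set (Finset P)} (hUV : U ⊆ V) (h : GCov T A U) :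
    GCov T A V :=
  (GCov_isBasicCover T).mono hUV h

theorem GCov.of_supset {A B : Finset P} {U : Set (Finset P)} (hBA : B ⊆ A) (hB : B ∈ U) :
    GCov T A U :=
  .le hBA (.refl hB)

theorem GCov.cut {A D : Finset P} {𝒞 U : Set (Finset P)} (hT : T A 𝒞) (hA : A ⊆ D)
    (h : ∀ B ∈ 𝒞, GCov T (D ∪ B) U) : GCov T D U := by
  have := GCov.ax D hT h
  rwa [Finset.union_eq_left.2 hA] at this

end GCov

/-! ### Derived rules of the Lawson theory -/

section Lawson

variable {S : Type*} {cov : S → Set S → Prop} {D : Finset (PatchGen S)}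
  {𝒰 : Set (Finset (PatchGen S))}

theorem lawsonCov_of_covS {A B : Finset S} (hAB : covS cov ↑A ↑B) (hB : PatchGen.l B ∈ D)
    (h : lawsonCov cov (D ∪ {PatchGen.l A}) 𝒰) : lawsonCov cov D 𝒰 :=
  GCov.cut (.L2 A B hAB) (by simpa using hB) (by rintro _ rfl; exact h)

theorem lawsonCov_of_union (hbc : IsBasicCover cov) {A B : Finset S}
    (hA : PatchGen.l A ∈ D) (hB : PatchGen.l B ∈ D)
    (h : lawsonCov cov (D ∪ {PatchGen.l (A ∪ B)}) 𝒰) : lawsonCov cov D 𝒰 := by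
  refine GCov.cut (.L3 A B) (by simp [Finset.insert_subset_iff, hA, hB]) ?_
  rintro _ ⟨C, hAC, hBC, rfl⟩
  refine lawsonCov_of_covS (A := A ∪ B) (B := C) ?_ (by simp) ?_
  · rw [Finset.coe_union]
    rintro a (ha | ha)
    · exact covS_of_wbS hbc hAC a ha
    · exact covS_of_wbS hbc hBC a ha
  · exact GCov.le (by grind) h

theorem lawsonCov_of_cov {a : S} {A : Finset S} (ha : cov a ↑A) (hr : PatchGen.r a ∈ D)
    (h : ∀ b ∈ A, lawsonCov cov (D ∪ {PatchGen.r b}) 𝒰) : lawsonCov cov D 𝒰 :=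
  GCov.cut (.R3 a A ha) (by simpa using hr) (by rintro _ ⟨b, hb, rfl⟩; exact h b hb)

theorem lawsonCov_of_disjoint (hbc : IsBasicCover cov) {a : S} {A : Finset S}
    (ha : cov a ↑A) (hr : PatchGen.r a ∈ D) (hl : PatchGen.l A ∈ D) :
    lawsonCov cov D 𝒰 := by
  refine lawsonCov_of_cov ha hr fun b hb => ?_
  refine lawsonCov_of_covS (A := {b}) (B := A) (hbc.covS_of_subset (by simpa using hb))
    (by simp [hl]) ?_
  exact GCov.cut (.D b) (by simp [Finset.insert_subset_iff]) (fun _ hB => hB.elim)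

theorem lawsonCov_of_forall_wb (hbc : IsBasicCover cov) {F : Finset S} {V : Set S}
    (hF : ∀ f ∈ F, ∃ v ∈ V, wb cov f v)
    (hl : lawsonCov cov (D ∪ {PatchGen.l F}) 𝒰)
    (hr : ∀ v ∈ V, lawsonCov cov (D ∪ {PatchGen.r v}) 𝒰) : lawsonCov cov D 𝒰 := by
  induction F using Finset.induction_on generalizing D with
  | empty => exact GCov.cut .L1 (by simp) (by rintro _ rfl; exact hl)
  | insert f F _ ih =>
    obtain ⟨v, hv, hfv⟩ := hF f (by simp)
    refine GCov.cut (.Loc f v hfv) (by simp) ?_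
    rintro _ (rfl | rfl)
    · refine ih (fun x hx => hF x (by simp [hx])) ?_ fun x hx => GCov.le ?_ (hr x hx)
      · refine lawsonCov_of_union hbc (A := {f}) (B := F) (by simp) (by simp) ?_
        rw [← Finset.insert_eq]
        exact GCov.le (by grind) hl
      · grind
    · exact hr v hv

theorem lawsonCov_of_wbS {w : S → Set S} (hbc : IsBasicCover cov) (hw : IsContinuous cov w)
    {A : Finset S} {V : Set S} (hAV : wbS cov ↑A V)
    (hl : lawsonCov cov (D ∪ {PatchGen.l A}) 𝒰)
    (hr : ∀ v ∈ V, lawsonCov cov (D ∪ {PatchGen.r v}) 𝒰) : lawsonCov cov D 𝒰 := by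
  obtain ⟨F, hAF, hF⟩ := hw.exists_finset_wb hbc hAV
  refine lawsonCov_of_forall_wb hbc hF ?_ hr
  exact lawsonCov_of_covS hAF (by simp) (GCov.le (by grind) hl)

/-! ### Compactness of the Lawson topology -/

/-- `g'` is an approximation of the generator `g` from below. -/
def GenBelow (cov : S → Set S → Prop) : PatchGen S → PatchGen S → Prop
  | .r a', .r a => wb cov a' a
  | .l A', .l A => wbS cov ↑A ↑A'
  | _, _ => False

/-- Every generator in `D` has an approximation in `D'`. -/
def ConjBelow (cov : S → Set S → Prop) (D' D : Finset (PatchGen S)) : Prop :=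
  ∀ g ∈ D, ∃ g' ∈ D', GenBelow cov g' g

theorem ConjBelow.union {C D' G G' : Finset (PatchGen S)}
    (h : ConjBelow cov D' C) (hG : ConjBelow cov G' G) :
    ConjBelow cov (D' ∪ G') (C ∪ G) := by
  intro g hg
  rcases Finset.mem_union.1 hg with hg | hg
  · obtain ⟨g', h₁, h₂⟩ := h g hg
    exact ⟨g', Finset.mem_union_left _ h₁, h₂⟩
  · obtain ⟨g', h₁, h₂⟩ := hG g hg
    exact ⟨g', Finset.mem_union_right _ h₁, h₂⟩

theorem ConjBelow.subset {C D D' : Finset (PatchGen S)} (h : ConjBelow cov D' D)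
    (hC : C ⊆ D) : ConjBelow cov D' C :=
  fun g hg => h g (hC hg)

theorem conjBelow_singleton {g g' : PatchGen S} (h : GenBelow cov g' g) :
    ConjBelow cov {g'} {g} := by
  simpa [ConjBelow] using h

theorem ConjBelow.exists_wb {D D' : Finset (PatchGen S)} (h : ConjBelow cov D' D) {a : S}
    (ha : PatchGen.r a ∈ D) : ∃ a', PatchGen.r a' ∈ D' ∧ wb cov a' a := by
  obtain ⟨_ | _, hg, hb⟩ := h _ ha
  · exact ⟨_, hg, hb⟩
  · exact hb.elim

theorem ConjBelow.exists_wbS {D D' : Finset (PatchGen S)} (h : ConjBelow cov D' D)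
    {A : Finset S} (hA : PatchGen.l A ∈ D) :
    ∃ A' : Finset S, PatchGen.l A' ∈ D' ∧ wbS cov ↑A ↑A' := by
  obtain ⟨_ | _, hg, hb⟩ := h _ hA
  · exact hb.elim
  · exact ⟨_, hg, hb⟩

theorem ConjBelow.lawsonCov (hbc : IsBasicCover cov) {D D' : Finset (PatchGen S)}
    (h : ConjBelow cov D' D) : lawsonCov cov D' {D} := by
  suffices ∀ E, E ⊆ D → ∀ F, D' ⊆ F → D ⊆ F ∪ E → FTP.lawsonCov cov F {D} from
    this D subset_rfl D' subset_rfl (by simp)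
  intro E
  induction E using Finset.induction_on with
  | empty => exact fun _ F _ hF => GCov.of_supset (by simpa using hF) rfl
  | insert g E _ ih =>
    intro hE F hD' hF
    have key : FTP.lawsonCov cov (F ∪ {g}) {D} :=
      ih (fun x hx => hE (by simp [hx])) _ (by grind) (by grind)
    have hg : g ∈ D := hE (by simp)
    cases g with
    | r a =>
      obtain ⟨a', ha', hb⟩ := h.exists_wb hg
      refine lawsonCov_of_cov (a := a') (A := {a}) ?_ (hD' ha') (by simpa using key)
      simpa using covS_of_wbS hbc (wbS_singleton_of_wb hbc hb) a' rfl
    | l A =>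
      obtain ⟨A', hA', hb⟩ := h.exists_wbS hg
      exact lawsonCov_of_covS (covS_of_wbS hbc hb) (hD' hA') key

/-- Finite approximations of covered conjunctions are finitely covered. -/
theorem exists_finset_lawsonCov_of_conjBelow {w : S → Set S} (hbc : IsBasicCover cov)
    (hw : IsContinuous cov w) (h : lawsonCov cov D 𝒰) {D' : Finset (PatchGen S)}
    (hD' : ConjBelow cov D' D) :
    ∃ 𝒱 : Finset (Finset (PatchGen S)), ↑𝒱 ⊆ 𝒰 ∧ lawsonCov cov D' ↑𝒱 := by
  induction h generalizing D' with
  | @refl A U hA => exact ⟨{A}, by simpa using hA, by simpa using hD'.lawsonCov hbc⟩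
  | le hBA _ ih => exact ih (hD'.subset hBA)
  | @ax A 𝒞 U C hT _ ih =>
    have hC : ConjBelow cov D' C := hD'.subset Finset.subset_union_left
    have hA : ConjBelow cov D' A := hD'.subset Finset.subset_union_right
    have rule_r : ∀ (a : S) (V : Set S), PatchGen.r a ∈ A → cov a V →
        (∀ v ∈ V, {PatchGen.r v} ∈ 𝒞) →
        ∃ 𝒱 : Finset (Finset (PatchGen S)), ↑𝒱 ⊆ U ∧ lawsonCov cov D' ↑𝒱 := by
      intro a V ha hV h𝒞
      obtain ⟨a', ha', hb⟩ := hA.exists_wb ha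
      obtain ⟨F, hF, haF⟩ := hb {x | ∃ v ∈ V, wb cov x v} <| hbc.2 _ _ _ hV fun v hv =>
        hbc.mono (fun _ hx => ⟨v, hv, hx⟩) (hw.cov_wb hbc v)
      obtain ⟨𝒱, h𝒱, hc⟩ := exists_finset_subset_forall (U := U)
        (P := fun x => lawsonCov cov (D' ∪ {PatchGen.r x}))
        (fun _ _ _ hVW => GCov.mono hVW) F fun x hx => by
          obtain ⟨v, hv, hxv⟩ := hF hx
          exact ih _ (h𝒞 v hv) (hC.union (conjBelow_singleton hxv))
      exact ⟨𝒱, h𝒱, lawsonCov_of_cov haF ha' hc⟩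
    cases hT with
    | R3 a A hcov => exact rule_r a A (by simp) hcov fun v hv => ⟨v, hv, rfl⟩
    | R4 a => exact rule_r a _ (by simp) (hw.cov_wb hbc a) fun v hv => ⟨v, hv, rfl⟩
    | L1 =>
      obtain ⟨𝒱, h𝒱, hc⟩ := ih _ rfl (D' := D' ∪ {PatchGen.l ∅})
        (hC.union (conjBelow_singleton (by simpa [GenBelow] using wbS_empty _)))
      exact ⟨𝒱, h𝒱, GCov.cut .L1 (by simp) (by rintro _ rfl; exact hc)⟩
    | L2 A B hAB =>
      obtain ⟨B', hB', hb⟩ := hA.exists_wbS (A := B) (by simp)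
      obtain ⟨𝒱, h𝒱, hc⟩ := ih _ rfl (D' := D' ∪ {PatchGen.l B'})
        (hC.union (conjBelow_singleton (wbS_of_covS_left hbc hAB hb)))
      exact ⟨𝒱, h𝒱, GCov.le (by simpa [Finset.insert_subset_iff] using hB') hc⟩
    | L3 A B =>
      obtain ⟨A', hA', ha⟩ := hA.exists_wbS (A := A) (by simp)
      obtain ⟨B', hB', hb⟩ := hA.exists_wbS (A := B) (by simp)
      obtain ⟨E, hE, hE'⟩ := hw.interpolate hbc (wbS_union hbc ha hb)
      obtain ⟨𝒱, h𝒱, hc⟩ := ih {PatchGen.l E}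
        ⟨E, wbS_of_covS_left hbc (hbc.covS_of_subset Set.subset_union_left) hE,
          wbS_of_covS_left hbc (hbc.covS_of_subset Set.subset_union_right) hE, rfl⟩
        (D' := D' ∪ {PatchGen.l (A' ∪ B')})
        (hC.union (conjBelow_singleton (by simpa [GenBelow] using hE')))
      exact ⟨𝒱, h𝒱, lawsonCov_of_union hbc hA' hB' hc⟩
    | Loc a b hab =>
      obtain ⟨G, hG, hG'⟩ := hw.exists_between hbc (wbS_singleton_of_wb hbc hab)
      obtain ⟨H, hGH, hH⟩ := hw.exists_between hbc
        (wbS_of_forall_wb hbc G (hbc.covS_of_subset subset_rfl) hG')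
      obtain ⟨𝒱, h𝒱, hc⟩ := ih _ (Or.inl rfl) (D' := D' ∪ {PatchGen.l G})
        (hC.union (conjBelow_singleton (by simpa [GenBelow] using hG)))
      obtain ⟨𝒲, h𝒲, hd⟩ := exists_finset_subset_forall (U := U)
        (P := fun x => lawsonCov cov (D' ∪ {PatchGen.r x}))
        (fun _ _ _ hVW => GCov.mono hVW) H fun x hx => by
          obtain ⟨v, rfl, hxv⟩ := hH x hx
          exact ih _ (Or.inr rfl) (hC.union (conjBelow_singleton hxv))
      refine ⟨𝒱 ∪ 𝒲, by simp [h𝒱, h𝒲], lawsonCov_of_wbS hbc hw hGH ?_ fun x hx => ?_⟩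
      · exact GCov.mono (by simp) hc
      · exact GCov.mono (by simp) (hd x hx)
    | D a =>
      obtain ⟨A', hA', ha⟩ := hA.exists_wbS (A := {a}) (by simp)
      obtain ⟨a', ha', hb⟩ := hA.exists_wb (a := a) (by simp)
      refine ⟨∅, by simp, lawsonCov_of_disjoint hbc ?_ ha' hA'⟩
      exact hbc.covS_trans (covS_of_wbS hbc (wbS_singleton_of_wb hbc hb))
        (covS_of_wbS hbc (by simpa using ha)) a' rfl

/-! ### The counit -/

theorem isBCM_epsL (cov : S → Set S → Prop) : IsBCM (lawsonCov cov) cov (epsL cov) := by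
  rintro a U hU D ⟨_, rfl, hD⟩
  refine GCov_trans hD ?_
  rintro _ rfl
  refine GCov.cut (.R4 _) subset_rfl ?_
  rintro _ ⟨b, hb, rfl⟩
  obtain ⟨U₀, hU₀, hbU⟩ := hb U hU
  refine lawsonCov_of_cov hbU (by simp) fun c hc => GCov.refl ⟨c, hU₀ hc, ?_⟩
  exact GCov.of_supset Finset.subset_union_right rfl

theorem isPerfect_epsL {w : S → Set S} (hbc : IsBasicCover cov) (hw : IsContinuous cov w) :
    IsPerfect (lawsonCov cov) cov (epsL cov) := by
  intro a b hab 𝒲 h𝒲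
  have hcov : lawsonCov cov ∅ ({{PatchGen.l {a}}} ∪ 𝒲) := by
    refine GCov.cut (.Loc a b hab) subset_rfl ?_
    rintro _ (rfl | rfl)
    · exact GCov.of_supset Finset.subset_union_right (Or.inl rfl)
    · refine GCov.le Finset.subset_union_right (GCov.mono Set.subset_union_right (h𝒲 _ ?_))
      exact ⟨b, rfl, GCov.refl rfl⟩
  obtain ⟨𝒱, h𝒱, hc⟩ := exists_finset_lawsonCov_of_conjBelow hbc hw hcov (D' := ∅)
    (by simp [ConjBelow])
  refine ⟨𝒱.filter (· ∈ 𝒲), fun D hD => (Finset.mem_filter.1 hD).2, ?_⟩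
  rintro D ⟨a, rfl, hD⟩
  refine GCov_trans hD ?_
  rintro _ rfl
  have hmeet : ∀ {E 𝒰}, lawsonCov cov E 𝒰 → ∀ G,
      lawsonCov cov (G ∪ E) {X | ∃ Y ∈ 𝒰, X = G ∪ Y} := by
    intro E 𝒰 hE G
    induction hE with
    | refl hA => exact GCov.refl ⟨_, hA, rfl⟩
    | le hBA _ ih => exact GCov.le (Finset.union_subset_union_right hBA) ih
    | ax C hT _ ih =>
      refine GCov.cut hT (by grind) fun B hB => GCov.le ?_ (ih B hB)
      grind
  refine GCov.le (Finset.union_subset subset_rfl (Finset.empty_subset _))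
    (GCov_trans (hmeet hc _) ?_)
  rintro _ ⟨Y, hY, rfl⟩
  rcases h𝒱 hY with rfl | hY'
  · exact GCov.cut (.D a) (by grind) (fun _ hB => hB.elim)
  · exact GCov.of_supset Finset.subset_union_right (by simp [Finset.mem_coe.1 hY, hY'])

end Lawson

/-! ### Formal topologies -/

section FormalTopology

variable {X : Type*} {cov : X → Set X → Prop} {le : X → X → Prop}

theorem IsFormalTopology.cov_of_le (h : IsFormalTopology cov le) {x y : X} {U : Set X}
    (hxy : le x y) (hy : cov y U) : cov x U :=
  h.1.2 _ _ _ (h.2.2.2.1 _ _ hxy) (by rintro _ rfl; exact hy)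

theorem IsFormalTopology.cov_of_meet (h : IsFormalTopology cov le) {x : X} {U V W : Set X}
    (hU : cov x U) (hV : cov x V)
    (hW : ∀ z, le z x → ∀ u ∈ U, ∀ v ∈ V, le z u → le z v → cov z W) : cov x W := by
  refine h.1.2 _ _ _ (h.2.2.2.2 _ _ _ (h.1.1 x {x} rfl) (h.2.2.2.2 _ _ _ hU hV)) ?_
  rintro z ⟨_, rfl, y, ⟨u, hu, v, hv, hyu, hyv⟩, hzx, hzy⟩
  exact hW z hzx u hu v hv (h.2.2.1 hzy hyu) (h.2.2.1 hzy hyv)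

/-- The pseudocomplement of a set of basic opens. -/
def starS (cov : X → Set X → Prop) (le : X → X → Prop) (U : Set X) : Set X :=
  {c | ∀ u ∈ U, covS cov (down le {c} {u}) ∅}

theorem IsFormalTopology.starS_of_le (h : IsFormalTopology cov le) {x y : X} {U : Set X}
    (hxy : le x y) (hy : y ∈ starS cov le U) : x ∈ starS cov le U := by
  rintro u hu z ⟨_, rfl, _, rfl, hzx, hzu⟩
  exact hy _ hu z ⟨y, rfl, _, rfl, h.2.2.1 hzx hxy, hzu⟩

theorem IsFormalTopology.cov_empty_of_starS (h : IsFormalTopology cov le) {x y : X}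
    {U V : Set X} (hxy : le x y) (hy : y ∈ starS cov le U) (hx : cov x U) : cov x V := by
  refine h.cov_of_meet (h.1.1 x {x} rfl) hx ?_
  rintro z - _ rfl u hu hzx hzu
  exact h.1.mono (Set.empty_subset V) (hy u hu z ⟨y, rfl, u, rfl, h.2.2.1 hzx hxy, hzu⟩)

/-- In a regular formal topology, `U ≪ V` implies that `V` together with the
pseudocomplement of `U` covers the whole space. -/
theorem IsFormalTopology.cov_starS_union (h : IsFormalTopology cov le)
    (hreg : Regular cov le) {U V : Set X} (hUV : wbS cov U V) (x : X) :
    cov x (starS cov le U ∪ V) := by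
  obtain ⟨F, hF, hU⟩ := hUV {y | ∃ v ∈ V, wc cov le y v} fun v hv =>
    h.1.mono (fun _ hy => ⟨v, hv, hy⟩) (hreg v)
  have key : ∀ (G : Finset X), (∀ y ∈ G, ∃ v ∈ V, wc cov le y v) → ∀ x,
      cov x (starS cov le ↑G ∪ V) := by
    intro G
    induction G using Finset.induction_on with
    | empty => exact fun _ x => h.1.1 _ _ (Or.inl (by simp [starS]))
    | insert y G _ ih =>
      intro hG x
      obtain ⟨v, hv, hyv⟩ := hG y (by simp)
      refine h.cov_of_meet (hyv x trivial) (ih (fun z hz => hG z (by simp [hz])) x) ?_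
      rintro z - p (hp | rfl) q hq hzp hzq
      · rcases hq with hq | hq
        · refine h.1.1 _ _ (Or.inl fun u hu => ?_)
          rcases Finset.mem_insert.1 (Finset.mem_coe.1 hu) with rfl | hu
          · rintro t ⟨_, rfl, _, rfl, htz, htu⟩
            exact hp t ⟨p, rfl, _, rfl, h.2.2.1 htz hzp, htu⟩
          · exact h.starS_of_le hzq hq u hu
        · exact h.cov_of_le hzq (h.1.1 _ _ (Or.inr hq))
      · exact h.cov_of_le hzp (h.1.1 _ _ (Or.inr hv))
  refine h.1.2 _ _ _ (key F (fun y hy => hF hy) x) ?_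
  rintro c (hc | hc)
  · refine h.1.1 _ _ (Or.inl fun u hu => ?_)
    rintro t ⟨_, rfl, _, rfl, htc, htu⟩
    exact h.cov_empty_of_starS htc hc (h.cov_of_le htu (hU _ hu))
  · exact h.1.1 _ _ (Or.inr hc)

/-! ### Models of geometric theories -/

variable {P : Type*} {T : Finset P → Set (Finset P) → Prop}

/-- The relation induced by an interpretation of generators. -/
def modelRel (cov : X → Set X → Prop) (G : P → Set X) : X → Finset P → Prop :=
  fun x D => ∀ g ∈ D, cov x (G g)

theorem IsFormalTopology.modelRel_of_le (h : IsFormalTopology cov le) {G : P → Set X}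
    {x y : X} {D : Finset P} (hxy : le x y) (hy : modelRel cov G y D) :
    modelRel cov G x D :=
  fun g hg => h.cov_of_le hxy (hy g hg)

theorem modelRel_union {G : P → Set X} {x : X} {C D : Finset P} (hC : modelRel cov G x C)
    (hD : modelRel cov G x D) : modelRel cov G x (C ∪ D) :=
  fun g hg => (Finset.mem_union.1 hg).elim (hC g) (hD g)

/-- An interpretation of generators validating the axioms of a theory induces a
formal topology map into the presented topology. -/
theorem IsFormalTopology.isFTM_modelRel (h : IsFormalTopology cov le) {G : P → Set X}
    (hG : ∀ A 𝒞, T A 𝒞 → ∀ x, modelRel cov G x A → cov x (rinv (modelRel cov G) 𝒞)) :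
    IsFTM cov le (GCov T) supord (modelRel cov G) := by
  refine ⟨?_, fun x _ => h.1.1 _ _ ⟨∅, trivial, by simp [modelRel]⟩, ?_⟩
  · rintro D 𝒰 hD x ⟨_, rfl, hx⟩
    induction hD generalizing x with
    | refl hA => exact h.1.1 _ _ ⟨_, hA, hx⟩
    | le hBA _ ih => exact ih x fun g hg => hx g (hBA hg)
    | ax C hT _ ih =>
      refine h.cov_of_meet (h.1.1 x {x} rfl)
        (hG _ _ hT x fun g hg => hx g (Finset.mem_union_right _ hg)) ?_
      rintro z hzx _ - y ⟨B, hB, hy⟩ - hzy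
      exact ih B hB z (modelRel_union
        (h.modelRel_of_le hzx fun g hg => hx g (Finset.mem_union_left _ hg))
        (h.modelRel_of_le hzy hy))
  · rintro A B z ⟨x, ⟨_, rfl, hx⟩, y, ⟨_, rfl, hy⟩, hzx, hzy⟩
    exact h.1.1 _ _ ⟨_, ⟨_, rfl, _, rfl, Finset.subset_union_left, Finset.subset_union_right⟩,
      modelRel_union (h.modelRel_of_le hzx hx) (h.modelRel_of_le hzy hy)⟩

theorem IsFTM.cov_of_GCov (h : IsFormalTopology cov le) {s : X → Finset P → Prop}
    (hs : IsFTM cov le (GCov T) supord s) {D : Finset P} {𝒰 : Set (Finset P)}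
    (hD : GCov T D 𝒰) {x : X} (hx : cov x (rinv s {D})) : cov x (rinv s 𝒰) :=
  h.1.2 _ _ _ hx (hs.1 D 𝒰 hD)

theorem IsFTM.cov_of_supset {s : X → Finset P → Prop}
    (hs : IsFTM cov le (GCov T) supord s) {A B : Finset P} (hBA : B ⊆ A) {x : X}
    (hx : s x A) : cov x (rinv s {B}) :=
  hs.1 A {B} (GCov.of_supset hBA rfl) x ⟨A, rfl, hx⟩

theorem IsFTM.cov_empty (h : IsFormalTopology cov le) {s : X → Finset P → Prop}
    (hs : IsFTM cov le (GCov T) supord s) (x : X) : cov x (rinv s {∅}) :=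
  h.1.2 _ _ _ (hs.2.1 x trivial) fun _ ⟨E, _, hy⟩ => hs.cov_of_supset (Finset.empty_subset E) hy

theorem IsFTM.cov_insert (h : IsFormalTopology cov le) {s : X → Finset P → Prop}
    (hs : IsFTM cov le (GCov T) supord s) {g : P} {D : Finset P} {x : X}
    (hg : cov x (rinv s {{g}})) (hD : cov x (rinv s {D})) :
    cov x (rinv s {insert g D}) := by
  refine h.1.2 _ _ _ (h.2.2.2.2 _ _ _ hg hD) fun y hy => ?_
  refine h.1.2 _ _ _ (hs.2.2 _ _ y hy) ?_
  rintro z ⟨E, ⟨_, rfl, _, rfl, hE, hE'⟩, hz⟩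
  exact hs.cov_of_supset (Finset.insert_subset (hE (Finset.mem_singleton_self g)) hE') hz

/-- A formal topology map into a presented topology is determined by its values on
generators. -/
theorem IsFTM.mapEq_modelRel (h : IsFormalTopology cov le) {s : X → Finset P → Prop}
    (hs : IsFTM cov le (GCov T) supord s) {G : P → Set X}
    (h₁ : ∀ g, covS cov (rinv s {{g}}) (G g)) (h₂ : ∀ g, covS cov (G g) (rinv s {{g}})) :
    MapEq cov s (modelRel cov G) := by
  constructor
  · rintro D x ⟨_, rfl, hx⟩
    refine h.1.1 _ _ ⟨_, rfl, fun g hg => ?_⟩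
    exact h.1.2 _ _ _
      (hs.cov_of_supset (Finset.singleton_subset_iff.2 hg) hx) (h₁ g)
  · rintro D x ⟨_, rfl, hx⟩
    rename_i D
    induction D using Finset.induction_on with
    | empty => exact hs.cov_empty h x
    | insert g D _ ih =>
      refine hs.cov_insert h (h.1.2 _ _ _ (hx g (by simp)) (h₂ g)) (ih fun g hg => ?_)
      exact hx g (by simp [hg])

end FormalTopology

/-! ### The universal property -/

section Universal

variable {S X : Type*} {cov : S → Set S → Prop} {cov' : X → Set X → Prop}
  {le' : X → X → Prop} {r : X → S → Prop}

/-- The interpretation of the generators of the Lawson topology of `S` induced by a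
map into `S`. -/
def lawsonGen (cov : S → Set S → Prop) (cov' : X → Set X → Prop) (le' : X → X → Prop)
    (r : X → S → Prop) : PatchGen S → Set X
  | .r a => rinv r {a}
  | .l A => {x | ∃ B : Finset S, wbS cov ↑A ↑B ∧ x ∈ starS cov' le' (rinv r ↑B)}

theorem rinv_mono (r : X → S → Prop) {U V : Set S} (hUV : U ⊆ V) : rinv r U ⊆ rinv r V :=
  fun _ ⟨a, ha, hx⟩ => ⟨a, hUV ha, hx⟩

theorem wbS_rinv_of_forall_wb (h : IsFormalTopology cov' le') (hr : IsPerfect cov' cov r)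
    (F : Finset S) {V : Set S} (hF : ∀ f ∈ F, ∃ v ∈ V, wb cov f v) :
    wbS cov' (rinv r ↑F) (rinv r V) := by
  intro W hW
  obtain ⟨W₀, hW₀, hc⟩ := exists_finset_subset_forall (U := W)
    (P := fun f Y => covS cov' (rinv r {f}) Y)
    (fun _ _ _ hVW ha x hx => h.1.mono hVW (ha x hx)) F
    (fun f hf => by
      obtain ⟨v, hv, hfv⟩ := hF f hf
      exact hr f v hfv W fun x hx =>
        hW x (rinv_mono r (Set.singleton_subset_iff.2 hv) hx))
  refine ⟨W₀, hW₀, ?_⟩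
  rintro x ⟨f, hf, hx⟩
  exact hc f hf x ⟨f, rfl, hx⟩

theorem lawsonGen_model {w : S → Set S} (hbc : IsBasicCover cov) (hw : IsContinuous cov w)
    (h : IsFormalTopology cov' le') (hreg : Regular cov' le') (hr : IsBCM cov' cov r)
    (hp : IsPerfect cov' cov r) (A : Finset (PatchGen S)) (𝒞 : Set (Finset (PatchGen S)))
    (hT : LawsonThy cov A 𝒞) (x : X)
    (hx : modelRel cov' (lawsonGen cov cov' le' r) x A) :
    cov' x (rinv (modelRel cov' (lawsonGen cov cov' le' r)) 𝒞) := by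
  have single : ∀ (y : X) (g : PatchGen S), y ∈ lawsonGen cov cov' le' r g →
      modelRel cov' (lawsonGen cov cov' le' r) y {g} := fun y g hy g' hg' => by
    rw [Finset.mem_singleton.1 hg']
    exact h.1.1 _ _ hy
  have single' : ∀ (y : X) (g : PatchGen S), y ∈ lawsonGen cov cov' le' r g → {g} ∈ 𝒞 →
      cov' y (rinv (modelRel cov' (lawsonGen cov cov' le' r)) 𝒞) := fun y g hy hg =>
    h.1.1 _ _ ⟨{g}, hg, single y g hy⟩
  have rule_r : ∀ (a : S) (V : Set S), PatchGen.r a ∈ A → cov a V →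
      (∀ v ∈ V, {PatchGen.r v} ∈ 𝒞) →
      cov' x (rinv (modelRel cov' (lawsonGen cov cov' le' r)) 𝒞) := by
    intro a V ha hV h𝒞
    refine h.1.2 _ _ _ (h.1.2 _ _ _ (hx _ ha) (hr a V hV)) ?_
    rintro y ⟨v, hv, hy⟩
    exact single' y (.r v) ⟨v, rfl, hy⟩ (h𝒞 v hv)
  cases hT with
  | R3 a A hcov => exact rule_r a A (by simp) hcov fun v hv => ⟨v, hv, rfl⟩
  | R4 a => exact rule_r a _ (by simp) (hw.cov_wb hbc a) fun v hv => ⟨v, hv, rfl⟩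
  | L1 =>
    refine single' x (.l ∅) ⟨∅, by simpa using wbS_empty _, ?_⟩ rfl
    rintro u ⟨a, ha, -⟩
    simp at ha
  | L2 A B hAB =>
    refine h.1.2 _ _ _ (hx (.l B) (by simp)) ?_
    rintro y ⟨B', hB', hy⟩
    exact single' y (.l A) ⟨B', wbS_of_covS_left hbc hAB hB', hy⟩ rfl
  | L3 A B =>
    refine h.cov_of_meet (hx (.l A) (by simp)) (hx (.l B) (by simp)) ?_
    rintro z - y ⟨A', hA', hy⟩ y' ⟨B', hB', hy'⟩ hzy hzy'
    obtain ⟨E, hE, hE'⟩ := hw.interpolate hbc (wbS_union hbc hA' hB')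
    refine single' z (.l E) ⟨A' ∪ B', by simpa using hE', ?_⟩
      ⟨E, wbS_of_covS_left hbc (hbc.covS_of_subset Set.subset_union_left) hE,
        wbS_of_covS_left hbc (hbc.covS_of_subset Set.subset_union_right) hE, rfl⟩
    rintro u ⟨a, ha, hu⟩
    rcases Finset.mem_union.1 (Finset.mem_coe.1 ha) with ha | ha
    · exact h.starS_of_le hzy hy u ⟨a, ha, hu⟩
    · exact h.starS_of_le hzy' hy' u ⟨a, ha, hu⟩
  | Loc a b hab =>
    obtain ⟨F, hF, hF'⟩ := hw.exists_between hbc (wbS_singleton_of_wb hbc hab)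
    refine h.1.2 _ _ _ (h.cov_starS_union hreg (wbS_rinv_of_forall_wb h hp F hF') x) ?_
    rintro y (hy | hy)
    · exact single' y (.l {a}) ⟨F, by simpa using hF, hy⟩ (Or.inl rfl)
    · exact single' y (.r b) hy (Or.inr rfl)
  | D a =>
    refine h.cov_of_meet (hx (.l {a}) (by simp)) (hx (.r a) (by simp)) ?_
    rintro z - y ⟨B, hB, hy⟩ u hu hzy hzu
    refine h.cov_empty_of_starS hzy hy (h.cov_of_le hzu ?_)
    exact hr a _ (covS_of_wbS hbc hB a (by simp)) u hu

theorem IsFTM.covS_rinv_r {s : X → Finset (PatchGen S) → Prop}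
    (hs : IsFTM cov' le' (lawsonCov cov) supord s)
    (a : S) : covS cov' (rinv (comp (epsL cov) s) {a}) (rinv s {{PatchGen.r a}}) := by
  rintro x ⟨_, rfl, D, hx, hD⟩
  exact hs.1 D _ hD x ⟨D, rfl, hx⟩

theorem covS_rinv_comp_epsL (h : IsBasicCover cov') (s : X → Finset (PatchGen S) → Prop)
    (a : S) : covS cov' (rinv s {{PatchGen.r a}}) (rinv (comp (epsL cov) s) {a}) := by
  rintro x ⟨_, rfl, hx⟩
  exact h.1 _ _ ⟨a, rfl, _, hx, GCov.refl rfl⟩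

theorem IsFTM.mapEq_lawsonGen {w : S → Set S} (hbc : IsBasicCover cov)
    (hw : IsContinuous cov w) (h : IsFormalTopology cov' le')
    {s : X → Finset (PatchGen S) → Prop} (hs : IsFTM cov' le' (lawsonCov cov) supord s)
    (hsr : MapEq cov' (comp (epsL cov) s) r) :
    MapEq cov' s (modelRel cov' (lawsonGen cov cov' le' r)) := by
  have h₁ : ∀ a, covS cov' (rinv s {{PatchGen.r a}}) (rinv r {a}) := fun a =>
    h.1.covS_trans (covS_rinv_comp_epsL h.1 s a) (hsr.1 a)
  have h₂ : ∀ a, covS cov' (rinv r {a}) (rinv s {{PatchGen.r a}}) := fun a =>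
    h.1.covS_trans (hsr.2 a) (hs.covS_rinv_r a)
  refine hs.mapEq_modelRel h ?_ ?_
  · rintro (a | A)
    · exact h₁ a
    · rintro x ⟨_, rfl, hx⟩
      refine h.1.2 _ _ _ (hs.1 {PatchGen.l A} _ (GCov.cut (.L3 A A) (by simp) fun B hB =>
        GCov.of_supset Finset.subset_union_right hB) x ⟨_, rfl, hx⟩) ?_
      rintro y ⟨_, ⟨C, hC, -, rfl⟩, hy⟩
      refine h.1.1 _ _ ⟨C, hC, ?_⟩
      rintro u ⟨c, hc, hu⟩ z ⟨_, rfl, _, rfl, hzy, hzu⟩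
      have hzr := h.cov_of_le hzu (h₂ c _ ⟨c, rfl, hu⟩)
      have hzl := h.cov_of_le (U := rinv s {{PatchGen.l C}}) hzy (h.1.1 _ _ ⟨_, rfl, hy⟩)
      have hbot : lawsonCov cov {PatchGen.r c, PatchGen.l C} ∅ :=
        lawsonCov_of_disjoint hbc (hbc.1 _ _ hc) (by simp) (by simp)
      refine h.1.2 _ _ _ (hs.cov_of_GCov h hbot (hs.cov_insert h hzr hzl)) ?_
      rintro _ ⟨_, hE, -⟩
      exact hE.elim
  · rintro (a | A)
    · exact h₂ a
    · rintro y ⟨B, hB, hy⟩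
      have htop : lawsonCov cov ∅
          ({{PatchGen.l A}} ∪ {E | ∃ b ∈ (B : Set S), E = {PatchGen.r b}}) :=
        lawsonCov_of_wbS hbc hw hB (GCov.of_supset Finset.subset_union_right (Or.inl rfl))
          fun b hb => GCov.of_supset Finset.subset_union_right (Or.inr ⟨b, hb, rfl⟩)
      refine h.cov_of_meet (h.1.1 y {y} rfl) (hs.cov_of_GCov h htop (hs.cov_empty h y)) ?_
      rintro z hzy _ - u ⟨_, rfl | ⟨b, hb, rfl⟩, hu⟩ - hzu
      · exact h.cov_of_le hzu (h.1.1 _ _ ⟨_, rfl, hu⟩)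
      · refine h.cov_empty_of_starS hzy hy (h.cov_of_le hzu ?_)
        exact h.1.mono (rinv_mono r (Set.singleton_subset_iff.2 hb)) (h₁ b u ⟨_, rfl, hu⟩)

end Universal

end FTP

namespace FTP

/-- `ε_L : L(S) → S` is a perfect basic cover map, and for any
compact regular formal topology `S'` and perfect basic cover map `r : S' → S`
there is a unique formal topology map `r̃ : S' → L(S)` with `ε_L ∘ r̃ = r`; hence
the Lawson construction is right adjoint to the forgetful functor from compact
regular formal topologies to continuous basic covers and perfect maps. -/
theorem lawson_universal_property {S : Type u}
    (cov : S → Set S → Prop) (hbc : IsBasicCover cov)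
    (w : S → Set S) (hw : IsContinuous cov w) :
    IsBCM (lawsonCov cov) cov (epsL cov) ∧
    IsPerfect (lawsonCov cov) cov (epsL cov) ∧
    ∀ (S' : Type u) (cov' : S' → Set S' → Prop) (le' : S' → S' → Prop),
      IsFormalTopology cov' le' → Compact cov' → Regular cov' le' →
      ∀ r : S' → S → Prop, IsBCM cov' cov r → IsPerfect cov' cov r →
        ∃ rt : S' → Finset (PatchGen S) → Prop,
          (IsFTM cov' le' (lawsonCov cov) supord rt ∧
           MapEq cov' (comp (epsL cov) rt) r) ∧
          ∀ rt' : S' → Finset (PatchGen S) → Prop,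
            IsFTM cov' le' (lawsonCov cov) supord rt' →
            MapEq cov' (comp (epsL cov) rt') r →
            MapEq cov' rt' rt := by
  refine ⟨isBCM_epsL cov, isPerfect_epsL hbc hw, ?_⟩
  intro X cov' le' h _ hreg r hr hp
  have hmap : IsFTM cov' le' (lawsonCov cov) supord
      (modelRel cov' (lawsonGen cov cov' le' r)) :=
    h.isFTM_modelRel (lawsonGen_model hbc hw h hreg hr hp)
  refine ⟨_, ⟨hmap, fun a => ?_, fun a => ?_⟩, fun s hs hsr => hs.mapEq_lawsonGen hbc hw h hsr⟩
  · refine h.1.covS_trans (hmap.covS_rinv_r a) ?_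
    rintro x ⟨_, rfl, hx⟩
    exact hx (.r a) (by simp)
  · refine h.1.covS_trans ?_ (covS_rinv_comp_epsL h.1 _ a)
    refine fun x hx => h.1.1 _ _ ⟨_, rfl, fun g hg => ?_⟩
    rw [Finset.mem_singleton.1 hg]
    exact h.1.1 _ _ hx

end FTP
end
end

section
/- If S is a continuous basic cover, then the lower powerlocale Lower(S) is a stably compact formal topology. -/
noncomputable section
open Classical

universe u v

namespace FTP

section GCov

variable {P : Type*} {T T' : Finset P → Set (Finset P) → Prop}

theorem GCov_mono {A : Finset P} {𝒰 𝒱 : Set (Finset P)} (h : GCov T A 𝒰) (hs : 𝒰 ⊆ 𝒱) :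
    GCov T A 𝒱 :=
  GCov_trans h fun _ hB => GCov.refl (hs hB)

theorem GCov_mono_theory (hT : ∀ A 𝒞, T A 𝒞 → T' A 𝒞) {A : Finset P} {𝒰 : Set (Finset P)}
    (h : GCov T A 𝒰) : GCov T' A 𝒰 := by
  induction h with
  | refl hA => exact GCov.refl hA
  | le hBA _ ih => exact GCov.le hBA ih
  | ax C hC _ ih => exact GCov.ax C (hT _ _ hC) ih

theorem GCov_union_left {A : Finset P} {𝒰 𝒱 : Set (Finset P)} (D : Finset P)
    (h : GCov T A 𝒰) (h' : ∀ B ∈ 𝒰, GCov T (D ∪ B) 𝒱) : GCov T (D ∪ A) 𝒱 := by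
  induction h with
  | refl hA => exact h' _ hA
  | le hBA _ ih => exact GCov.le (Finset.union_subset_union_right hBA) (ih h')
  | ax C hT _ ih =>
    rw [← Finset.union_assoc]
    refine GCov.ax (D ∪ C) hT fun B hB => ?_
    rw [Finset.union_assoc]
    exact ih B hB h'

/-- If each member of a finite family is covered by a finite part of `𝒱`, then a single finite
part of `𝒱` covers the whole family. -/
theorem GCov_exists_finset_of_finite {𝒞 𝒱 : Set (Finset P)} (h𝒞 : 𝒞.Finite)
    {f : Finset P → Finset P}
    (h : ∀ B ∈ 𝒞, ∃ 𝒱₀ : Finset (Finset P), ↑𝒱₀ ⊆ 𝒱 ∧ GCov T (f B) ↑𝒱₀) :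
    ∃ 𝒱₀ : Finset (Finset P), ↑𝒱₀ ⊆ 𝒱 ∧ ∀ B ∈ 𝒞, GCov T (f B) ↑𝒱₀ := by
  choose! g hg hcov using h
  refine ⟨h𝒞.toFinset.biUnion g, fun U hU => ?_, fun B hB => GCov_mono (hcov B hB) ?_⟩
  · simp only [Finset.coe_biUnion, Set.mem_iUnion, Finset.mem_coe, Set.Finite.mem_toFinset] at hU
    obtain ⟨B, hB, hU⟩ := hU
    exact hg B hB hU
  · exact_mod_cast Finset.subset_biUnion_of_mem g (h𝒞.mem_toFinset.2 hB)

/-- The cover presented by a coherent theory is finitary. -/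
theorem GCov_exists_finset (hT : ∀ A 𝒞, T A 𝒞 → 𝒞.Finite) {A : Finset P}
    {𝒰 : Set (Finset P)} (h : GCov T A 𝒰) :
    ∃ 𝒰₀ : Finset (Finset P), ↑𝒰₀ ⊆ 𝒰 ∧ GCov T A ↑𝒰₀ := by
  induction h with
  | @refl A _ hA => exact ⟨{A}, by simpa using hA, GCov.refl (by simp)⟩
  | le hBA _ ih =>
    obtain ⟨𝒰₀, hs, hc⟩ := ih
    exact ⟨𝒰₀, hs, GCov.le hBA hc⟩
  | ax C hC _ ih =>
    obtain ⟨𝒰₀, hs, hc⟩ := GCov_exists_finset_of_finite (hT _ _ hC) ih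
    exact ⟨𝒰₀, hs, GCov.ax C hC hc⟩

end GCov

section Lower

variable {S : Type*} {cov : S → Set S → Prop}

/-- The coherent part of the lower powerlocale theory: the axioms (R3) only. -/
inductive LowerFinThy (cov : S → Set S → Prop) : Finset S → Set (Finset S) → Prop where
  | R3 (a : S) (A : Finset S) :
      cov a ↑A → LowerFinThy cov {a} {B | ∃ b ∈ A, B = ({b} : Finset S)}

theorem LowerFinThy.finite {A : Finset S} {𝒞 : Set (Finset S)} (h : LowerFinThy cov A 𝒞) :
    𝒞.Finite := by
  obtain ⟨a, F, -⟩ := h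
  refine (F.image fun b => ({b} : Finset S)).finite_toSet.subset ?_
  rintro _ ⟨b, hb, rfl⟩
  exact Finset.mem_coe.2 (Finset.mem_image_of_mem _ hb)

theorem LowerFinThy.lowerThy {A : Finset S} {𝒞 : Set (Finset S)} (h : LowerFinThy cov A 𝒞) :
    LowerThy cov A 𝒞 := by
  obtain ⟨a, F, h⟩ := h
  exact LowerThy.R3 a F h

/-- `B` strictly refines `A` if every element of `A` has an element of `B` way below it. -/
def StrictRefines (cov : S → Set S → Prop) (B A : Finset S) : Prop :=
  ∀ a ∈ A, ∃ b ∈ B, wb cov b a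

theorem StrictRefines.union {A A' B B' : Finset S} (h : StrictRefines cov B A)
    (h' : StrictRefines cov B' A') : StrictRefines cov (B ∪ B') (A ∪ A') := by
  intro a ha
  rcases Finset.mem_union.1 ha with ha | ha
  · obtain ⟨b, hb, hba⟩ := h a ha
    exact ⟨b, Finset.mem_union_left _ hb, hba⟩
  · obtain ⟨b, hb, hba⟩ := h' a ha
    exact ⟨b, Finset.mem_union_right _ hb, hba⟩

theorem StrictRefines.lowerCov_singleton (hbc : IsBasicCover cov) {A B : Finset S}
    (h : StrictRefines cov B A) : lowerCov cov B {A} := by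
  suffices H : ∀ A : Finset S, StrictRefines cov B A → lowerCov cov B {B ∪ A} from
    GCov_trans (H A h) fun C hC => by
      rw [Set.mem_singleton_iff.1 hC]
      exact GCov.le Finset.subset_union_right (GCov.refl rfl)
  intro A
  induction A using Finset.induction_on with
  | empty => exact fun _ => GCov.refl (by simp)
  | insert a A _ ih =>
    intro h
    refine GCov_trans (ih fun x hx => h x (Finset.mem_insert_of_mem hx)) fun C hC => ?_
    obtain rfl := Set.mem_singleton_iff.1 hC
    obtain ⟨b, hb, hba⟩ := h a (Finset.mem_insert_self _ _)
    have hcov : cov b (↑({a} : Finset S)) := by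
      obtain ⟨F, hF, hbF⟩ := hba {a} (hbc.1 _ _ rfl)
      exact hbc.2 _ _ _ hbF fun x hx => hbc.1 _ _ (by simpa using hF hx)
    refine GCov.le (B := (B ∪ A) ∪ {b}) (by grind)
      (GCov.ax (B ∪ A) (LowerThy.R3 b {a} hcov) ?_)
    rintro _ ⟨x, hx, rfl⟩
    obtain rfl := Finset.mem_singleton.1 hx
    exact GCov.refl (by rw [Set.mem_singleton_iff]; grind)

theorem lowerCov_strictRefines (A : Finset S) : lowerCov cov A {B | StrictRefines cov B A} := by
  induction A using Finset.induction_on with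
  | empty => exact GCov.refl (by simp [StrictRefines])
  | insert a A _ ih =>
    rw [Finset.insert_eq]
    refine GCov_union_left _ ih fun B hB => ?_
    rw [Finset.union_comm]
    refine GCov.ax B (LowerThy.R4 a) ?_
    rintro _ ⟨b, hb, rfl⟩
    refine GCov.refl ?_
    rw [Set.mem_ofPred_eq, Finset.union_comm {a}]
    refine StrictRefines.union hB fun x hx => ?_
    obtain rfl := Finset.mem_singleton.1 hx
    exact ⟨b, Finset.mem_singleton_self b, hb⟩

/-- An axiom-elimination step: a strict refinement of `C ∪ {a}` is finitarily covered once the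
strict refinements of all `C ∪ {x}` are, for `x` in some cover of `a`. -/
theorem lowerFin_of_strictRefines_union {w : S → Set S} (hbc : IsBasicCover cov)
    (hw : IsContinuous cov w) {a : S} {X : Set S} (haX : cov a X) {B C : Finset S}
    {𝒱 : Set (Finset S)} (hB : StrictRefines cov B (C ∪ {a}))
    (h : ∀ x ∈ X, ∀ D, StrictRefines cov D (C ∪ {x}) → GCov (LowerFinThy cov) D 𝒱) :
    GCov (LowerFinThy cov) B 𝒱 := by
  obtain ⟨b, hbB, hba⟩ := hB a (by simp)
  obtain ⟨F, hF, hbF⟩ := hba (⋃ x ∈ X, w x) (hbc.2 _ _ _ haX fun x hx =>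
    hbc.2 _ _ _ (hw.2 x) fun y hy => hbc.1 _ _ (Set.mem_biUnion hx hy))
  refine GCov.le (B := B ∪ {b}) (by grind) (GCov.ax B (LowerFinThy.R3 b F hbF) ?_)
  rintro _ ⟨u, hu, rfl⟩
  obtain ⟨x, hx, hux⟩ := Set.mem_iUnion₂.1 (hF hu)
  refine h x hx _ (StrictRefines.union (fun c hc => hB c (Finset.mem_union_left _ hc))
    fun y hy => ?_)
  obtain rfl := Finset.mem_singleton.1 hy
  exact ⟨u, Finset.mem_singleton_self u, hw.1 _ _ hux⟩

theorem lowerFin_of_lowerCov {w : S → Set S} (hbc : IsBasicCover cov)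
    (hw : IsContinuous cov w) {A : Finset S} {𝒰 : Set (Finset S)} (h : lowerCov cov A 𝒰) :
    ∀ B, StrictRefines cov B A →
      GCov (LowerFinThy cov) B {C | ∃ U ∈ 𝒰, StrictRefines cov C U} := by
  induction h with
  | refl hA => exact fun B hB => GCov.refl ⟨_, hA, hB⟩
  | le hBA _ ih => exact fun B hB => ih B fun a ha => hB a (hBA ha)
  | ax C hC _ ih =>
    intro B hB
    cases hC with
    | R3 a F haF =>
      exact lowerFin_of_strictRefines_union hbc hw haF hB fun x hx => ih _ ⟨x, hx, rfl⟩
    | R4 a =>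
      exact lowerFin_of_strictRefines_union hbc hw (hw.2 a) hB fun x hx =>
        ih _ ⟨x, hw.1 _ _ hx, rfl⟩

theorem StrictRefines.wb_lowerCov {w : S → Set S} (hbc : IsBasicCover cov)
    (hw : IsContinuous cov w) {A B : Finset S} (h : StrictRefines cov B A) :
    wb (lowerCov cov) B A := by
  intro 𝒰 hA
  obtain ⟨𝒲, h𝒲, hB⟩ := GCov_exists_finset (fun _ _ => LowerFinThy.finite)
    (lowerFin_of_lowerCov hbc hw hA B h)
  obtain ⟨𝒰₀, hs, hc⟩ := GCov_exists_finset_of_finite (T := LowerThy cov) (𝒱 := 𝒰) (f := id)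
    𝒲.finite_toSet fun C hC => by
      obtain ⟨U, hU, hCU⟩ := h𝒲 hC
      exact ⟨{U}, by simpa using hU, by
        rw [Finset.coe_singleton]
        exact hCU.lowerCov_singleton hbc⟩
  exact ⟨𝒰₀, hs, GCov_trans (GCov_mono_theory (fun _ _ => LowerFinThy.lowerThy) hB) hc⟩

end Lower

/-- If `S` is a continuous basic cover, then the lower
powerlocale `Lower(S)` is a stably compact formal topology. -/
theorem lower_powerlocale_stably_compact {S : Type u}
    (cov : S → Set S → Prop) (hbc : IsBasicCover cov)
    (w : S → Set S) (hw : IsContinuous cov w) :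
    Compact (lowerCov cov) ∧
    (∃ wL : Finset S → Set (Finset S), IsContinuous (lowerCov cov) wL) ∧
    Stable (lowerCov cov) supord := by
  refine ⟨fun 𝒲 h𝒲 => ?_, ⟨fun A => {B | StrictRefines cov B A},
    fun A B hB => hB.wb_lowerCov hbc hw, lowerCov_strictRefines⟩, ?_⟩
  · have h : StrictRefines cov (∅ : Finset S) ∅ := by simp [StrictRefines]
    obtain ⟨𝒲₀, hs, hc⟩ := h.wb_lowerCov hbc hw 𝒲 (h𝒲 ∅ (Set.mem_univ _))
    exact ⟨𝒲₀, hs, fun A _ => GCov.le (Finset.empty_subset A) hc⟩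
  · intro A A' B B' hA hB 𝒲 h𝒲
    obtain ⟨𝒞, h𝒞, hA𝒞⟩ := hA _ (lowerCov_strictRefines A')
    obtain ⟨𝒟, h𝒟, hB𝒟⟩ := hB _ (lowerCov_strictRefines B')
    have hAB' : lowerCov cov (A' ∪ B') 𝒲 :=
      h𝒲 _ ⟨A', rfl, B', rfl, Finset.subset_union_left, Finset.subset_union_right⟩
    obtain ⟨𝒲₀, hs, hc⟩ := GCov_exists_finset_of_finite (T := LowerThy cov) (𝒱 := 𝒲) (f := id)
      (𝒞 := ↑((𝒞 ×ˢ 𝒟).image fun p => p.1 ∪ p.2)) (Finset.finite_toSet _) fun E hE => by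
        obtain ⟨⟨C, D⟩, hCD, rfl⟩ := Finset.mem_image.1 (Finset.mem_coe.1 hE)
        obtain ⟨hC, hD⟩ := Finset.mem_product.1 hCD
        exact (StrictRefines.union (h𝒞 hC) (h𝒟 hD)).wb_lowerCov hbc hw 𝒲 hAB'
    refine ⟨𝒲₀, hs, ?_⟩
    rintro E ⟨_, rfl, _, rfl, hAE, hBE⟩
    refine GCov.le (Finset.union_subset hAE hBE)
      (GCov_union_left _ hB𝒟 fun D hD => ?_)
    rw [Finset.union_comm]
    refine GCov_union_left _ hA𝒞 fun C hC => ?_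
    rw [Finset.union_comm]
    exact hc _ (Finset.mem_coe.2 (Finset.mem_image.2 ⟨(C, D), Finset.mem_product.2 ⟨hC, hD⟩, rfl⟩))

end FTP
end
end
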